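/- Let k ≥ 0 and m ≥ 0 be natural numbers and let X and X' be bulb-headed components with g(X) = g(X') = i for some finite i. If g(bulb^k ++ socket^m ++ X) is finite, then g(bulb^k ++ socket^m ++ X') = g(bulb^k ++ socket^m ++ X). In other words, when bulb^k ++ socket^m ++ X is not the moon, its extended Grundy value does not depend on the shape of X but only on the value i. -/

import Mathlib

/-- A piece of a Christmas lights' fixture: a (broken-but-replaceable) bulb
or a (broken) socket. -/
inductive Piece : Type
  | bulb : Piece
  | socket : Piece
  deriving DecidableEq

/-- A component is a finite list of pieces; index 0 is nearest the plug. -/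
abbrev Component := List Piece

/-- A sequence of `n` bulbs. -/
def bulbs (n : ℕ) : Component := List.replicate n Piece.bulb

/-- A sequence of `m` sockets. -/
def sockets (m : ℕ) : Component := List.replicate m Piece.socket

/-- The entries at positions `i-1` and `i+1` both exist and both equal bulb. -/
def Sandwiched (L : Component) (i : ℕ) : Prop :=
  0 < i ∧ L[i-1]? = some Piece.bulb ∧ L[i+1]? = some Piece.bulb

/-- `L'` is obtained from `L` by a quiet move: either fix a bulb (truncating
everything to its right), or remove a socket that is not sandwiched between
two bulbs. -/
def QuietOption (L L' : Component) : Prop :=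
  (∃ i, L[i]? = some Piece.bulb ∧ L' = L.take i) ∨
  (∃ i, L[i]? = some Piece.socket ∧ ¬ Sandwiched L i ∧ L' = L.eraseIdx i)

/-- `L'` is obtained from `L` by a carry-on move: remove a socket sandwiched
between two bulbs (the mover must move again). -/
def CarryOption (L L' : Component) : Prop :=
  ∃ i, L[i]? = some Piece.socket ∧ Sandwiched L i ∧ L' = L.eraseIdx i

/-- A position is a finite multiset of components. -/
abbrev Position := Multiset Component

/-- Total number of pieces in a position. -/
def Position.size (pos : Position) : ℕ := (pos.map List.length).sum

/-- Fuel-indexed winning predicate; `WinN n pos` agrees with the intended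
`Win pos` whenever `n ≥ Position.size pos`, since every move strictly
decreases the total number of pieces. -/
def WinN : ℕ → Position → Prop
  | 0, _ => False
  | n+1, pos =>
      (∃ L ∈ pos, ∃ L', QuietOption L L' ∧ ¬ WinN n (L' ::ₘ pos.erase L)) ∨
      (∃ L ∈ pos, ∃ L', CarryOption L L' ∧ WinN n (L' ::ₘ pos.erase L))

/-- The player to move wins `pos` (normal play convention): some quiet move
leads to a losing position for the opponent, or some carry-on move leads to a
position the mover (still to move) wins. -/
def Win (pos : Position) : Prop := WinN (Position.size pos) pos

open Classical in
/-- Fuel-indexed extended Grundy value; `gN n L` agrees with the intended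
value whenever `n ≥ L.length`, since every option of `L` is strictly
shorter. -/
noncomputable def gN : ℕ → Component → ℕ∞
  | 0, _ => 0
  | n+1, L =>
      let S : Set ℕ := {k | ∃ L', QuietOption L L' ∧ gN n L' = (k : ℕ∞)}
      let C : Set ℕ∞ := {v | ∃ L', CarryOption L L' ∧ gN n L' = v}
      if (⊤ : ℕ∞) ∈ C ∨ (∃ a ∈ C, ∃ b ∈ C, a ≠ b) ∨
          (∃ k : ℕ, C = {(k : ℕ∞)} ∧ k ∈ S) then ⊤
      else if h : ∃ k : ℕ, C = {(k : ℕ∞)} ∧ k ∉ S then (h.choose : ℕ∞)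
      else ((sInf {k : ℕ | k ∉ S} : ℕ) : ℕ∞)

/-- The extended Grundy value `g L ∈ ℕ ∪ {∞}` of a component. -/
noncomputable def g (L : Component) : ℕ∞ := gN L.length L

/-- A component is bulb-headed if it is empty or its first piece is a bulb. -/
def BulbHeaded (L : Component) : Prop := L = [] ∨ L.head? = some Piece.bulb

theorem QuietOption.length_lt {L L' : Component} (h : QuietOption L L') :
    L'.length < L.length := by
  rcases h with ⟨i, hi, rfl⟩ | ⟨i, hi, -, rfl⟩
  · have := (List.getElem?_eq_some_iff.mp hi).1
    simp [this]
  · have := (List.getElem?_eq_some_iff.mp hi).1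
    rw [List.length_eraseIdx_of_lt this]
    omega

theorem CarryOption.length_lt {L L' : Component} (h : CarryOption L L') :
    L'.length < L.length := by
  rcases h with ⟨i, hi, -, rfl⟩
  have := (List.getElem?_eq_some_iff.mp hi).1
  rw [List.length_eraseIdx_of_lt this]
  omega

open Classical in
/-- The extended mex: the value of a component whose quiet options have the finite values `S` and
whose carry-on options have the values `C`. -/
noncomputable def extendedMex (S : Set ℕ) (C : Set ℕ∞) : ℕ∞ :=
  if (⊤ : ℕ∞) ∈ C ∨ (∃ a ∈ C, ∃ b ∈ C, a ≠ b) ∨ (∃ k : ℕ, C = {(k : ℕ∞)} ∧ k ∈ S) then ⊤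
  else if h : ∃ k : ℕ, C = {(k : ℕ∞)} ∧ k ∉ S then (h.choose : ℕ∞)
  else ((sInf {k : ℕ | k ∉ S} : ℕ) : ℕ∞)

theorem gN_succ (n : ℕ) (L : Component) :
    gN (n + 1) L = extendedMex {k | ∃ L', QuietOption L L' ∧ gN n L' = (k : ℕ∞)}
      {v | ∃ L', CarryOption L L' ∧ gN n L' = v} :=
  rfl

theorem gN_succ_nil (n : ℕ) : gN (n + 1) [] = 0 := by
  have hq : ∀ L', ¬ QuietOption [] L' := fun L' h => by simpa using h.length_lt
  have hc : ∀ L', ¬ CarryOption [] L' := fun L' h => by simpa using h.length_lt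
  have hne : ∀ k : ℕ, (∅ : Set ℕ∞) ≠ {(k : ℕ∞)} := fun k h =>
    (Set.singleton_ne_empty _) h.symm
  simp [gN_succ, extendedMex, hq, hc, hne]

theorem gN_eq_gN {n m : ℕ} {L : Component} (hn : L.length ≤ n) (hm : L.length ≤ m) :
    gN n L = gN m L := by
  induction n generalizing m L with
  | zero =>
    obtain rfl : L = [] := List.length_eq_zero_iff.mp (by omega)
    cases m with
    | zero => rfl
    | succ m => rw [gN_succ_nil]; rfl
  | succ n ih =>
    cases m with
    | zero =>
      obtain rfl : L = [] := List.length_eq_zero_iff.mp (by omega)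
      rw [gN_succ_nil]; rfl
    | succ m =>
      have hq : ∀ v : ℕ∞, (∃ L', QuietOption L L' ∧ gN n L' = v) ↔
          ∃ L', QuietOption L L' ∧ gN m L' = v := fun v =>
        exists_congr fun L' => and_congr_right fun h => by
          have := h.length_lt
          rw [ih (by omega) (show L'.length ≤ m by omega)]
      have hc : ∀ v : ℕ∞, (∃ L', CarryOption L L' ∧ gN n L' = v) ↔
          ∃ L', CarryOption L L' ∧ gN m L' = v := fun v =>
        exists_congr fun L' => and_congr_right fun h => by
          have := h.length_lt
          rw [ih (by omega) (show L'.length ≤ m by omega)]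
      simp only [gN_succ, hq, hc]

/-- The values of the quiet options of a component. -/
def quietValues (L : Component) : Set ℕ∞ := {v | ∃ L', QuietOption L L' ∧ g L' = v}

/-- The values of the carry-on options of a component. -/
def carryValues (L : Component) : Set ℕ∞ := {v | ∃ L', CarryOption L L' ∧ g L' = v}

theorem exists_notMem_quietValues (L : Component) : ∃ n : ℕ, (n : ℕ∞) ∉ quietValues L := by
  have hfin : (quietValues L).Finite := by
    refine (((Set.finite_lt_nat L.length).image fun i => g (L.take i)).union
      ((Set.finite_lt_nat L.length).image fun i => g (L.eraseIdx i))).subset ?_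
    rintro v ⟨L', ⟨i, hi, rfl⟩ | ⟨i, hi, -, rfl⟩, rfl⟩
    · exact Or.inl ⟨i, (List.getElem?_eq_some_iff.mp hi).1, rfl⟩
    · exact Or.inr ⟨i, (List.getElem?_eq_some_iff.mp hi).1, rfl⟩
  exact (hfin.preimage (Nat.cast_injective (R := ℕ∞)).injOn).exists_notMem

theorem extendedMex_eq_coe_iff {S : Set ℕ} {C : Set ℕ∞} (hex : ∃ n, n ∉ S) {n : ℕ} :
    extendedMex S C = n ↔
      n ∉ S ∧ (∀ v ∈ C, v = n) ∧ (C.Nonempty ∨ ∀ j < n, j ∈ S) := by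
  unfold extendedMex
  split_ifs with h1 h2
  · refine iff_of_false (ENat.natCast_ne_top n).symm ?_
    rintro ⟨hn, hC, -⟩
    rcases h1 with h | ⟨a, ha, b, hb, hab⟩ | ⟨k, rfl, hk⟩
    · exact ENat.natCast_ne_top n (hC _ h).symm
    · exact hab ((hC a ha).trans (hC b hb).symm)
    · exact hn (Nat.cast_injective (R := ℕ∞) (hC _ rfl) ▸ hk)
  · obtain ⟨hC, hS⟩ := h2.choose_spec
    generalize h2.choose = k at hC hS
    subst hC
    simp only [Set.mem_singleton_iff, forall_eq, Set.singleton_nonempty, true_or, and_true]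
    constructor
    · intro h
      exact ⟨Nat.cast_injective (R := ℕ∞) h ▸ hS, h⟩
    · exact fun h => h.2
  · have hC : C = ∅ := by
      by_contra hne
      obtain ⟨v, hv⟩ := Set.nonempty_iff_ne_empty.mpr hne
      push Not at h1 h2
      obtain ⟨h3, h4, h5⟩ := h1
      obtain ⟨k, rfl⟩ := ENat.ne_top_iff_exists.mp (fun h : v = ⊤ => h3 (h ▸ hv))
      have hk : C = {(k : ℕ∞)} := Set.eq_singleton_iff_unique_mem.mpr ⟨hv, fun w hw => h4 w hw _ hv⟩
      exact h5 k hk (h2 k hk)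
    subst hC
    have hmem : sInf {k : ℕ | k ∉ S} ∉ S := Nat.sInf_mem hex
    have hlt : ∀ j < sInf {k : ℕ | k ∉ S}, j ∈ S := fun j hj =>
      not_not.mp (Nat.notMem_of_lt_sInf hj)
    generalize sInf {k : ℕ | k ∉ S} = r at hmem hlt
    simp only [Nat.cast_inj, Set.mem_empty_iff_false, false_imp_iff, implies_true, true_and,
      Set.not_nonempty_empty, false_or]
    constructor
    · rintro rfl
      exact ⟨hmem, hlt⟩
    · rintro ⟨hn, hlt'⟩
      rcases lt_trichotomy r n with h | h | h
      · exact absurd (hlt' _ h) hmem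
      · exact h
      · exact absurd (hlt _ h) hn

theorem g_eq_coe_iff {L : Component} {n : ℕ} :
    g L = n ↔ (n : ℕ∞) ∉ quietValues L ∧ (∀ v ∈ carryValues L, v = n) ∧
      ((carryValues L).Nonempty ∨ ∀ j < n, (j : ℕ∞) ∈ quietValues L) := by
  have hg : g L = gN (L.length + 1) L := gN_eq_gN le_rfl (by omega)
  have hq : ∀ v : ℕ∞, (∃ L', QuietOption L L' ∧ gN L.length L' = v) ↔ v ∈ quietValues L :=
    fun v => exists_congr fun L' => and_congr_right fun h => by
      rw [g, gN_eq_gN h.length_lt.le le_rfl]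
  have hc : ∀ v : ℕ∞, (∃ L', CarryOption L L' ∧ gN L.length L' = v) ↔ v ∈ carryValues L :=
    fun v => exists_congr fun L' => and_congr_right fun h => by
      rw [g, gN_eq_gN h.length_lt.le le_rfl]
  rw [hg, gN_succ]
  simp only [hq, hc]
  exact extendedMex_eq_coe_iff (exists_notMem_quietValues L)

theorem g_ne_top_of_carryValues_eq_empty {L : Component} (h : carryValues L = ∅) : g L ≠ ⊤ := by
  have hex := exists_notMem_quietValues L
  rw [(g_eq_coe_iff (n := sInf {k : ℕ | (k : ℕ∞) ∉ quietValues L})).mpr]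
  · exact ENat.natCast_ne_top _
  · refine ⟨Nat.sInf_mem hex, by simp [h], Or.inr fun j hj => ?_⟩
    exact not_not.mp (Nat.notMem_of_lt_sInf hj)

theorem BulbHeaded.ne_socket {X : Component} (h : BulbHeaded X) :
    X[0]? ≠ some Piece.socket := by
  rcases h with rfl | h
  · simp
  · rw [← List.head?_eq_getElem?, h]
    simp

theorem sandwiched_append_iff {P X : Component} {i : ℕ} (hi : 0 < i) :
    Sandwiched (P ++ X) (P.length + i) ↔ Sandwiched X i := by
  unfold Sandwiched
  rw [List.getElem?_append_right (by omega), List.getElem?_append_right (by omega),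
    show P.length + i - 1 - P.length = i - 1 by omega,
    show P.length + i + 1 - P.length = i + 1 by omega]
  simp [hi]

theorem quietOption_append_iff {P X L' : Component} (hX : BulbHeaded X) :
    QuietOption (P ++ X) L' ↔ (∃ Y, QuietOption X Y ∧ L' = P ++ Y) ∨
      (∃ i, P[i]? = some Piece.bulb ∧ L' = P.take i) ∨
      (∃ i, P[i]? = some Piece.socket ∧ ¬ Sandwiched (P ++ X) i ∧ L' = P.eraseIdx i ++ X) := by
  constructor
  · rintro (⟨i, hi, rfl⟩ | ⟨i, hi, hs, rfl⟩)
    · rcases lt_or_ge i P.length with h | h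
      · rw [List.getElem?_append_left h] at hi
        exact Or.inr (Or.inl ⟨i, hi, List.take_append_of_le_length h.le⟩)
      · obtain ⟨j, rfl⟩ := Nat.exists_eq_add_of_le h
        rw [List.getElem?_append_right h, Nat.add_sub_cancel_left] at hi
        exact Or.inl ⟨_, Or.inl ⟨j, hi, rfl⟩, List.take_length_add_append j⟩
    · rcases lt_or_ge i P.length with h | h
      · rw [List.getElem?_append_left h] at hi
        exact Or.inr (Or.inr ⟨i, hi, hs, List.eraseIdx_append_of_lt_length h _⟩)
      · obtain ⟨j, rfl⟩ := Nat.exists_eq_add_of_le h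
        rw [List.getElem?_append_right h, Nat.add_sub_cancel_left] at hi
        have hj : 0 < j := Nat.pos_of_ne_zero fun h0 => hX.ne_socket (h0 ▸ hi)
        rw [sandwiched_append_iff hj] at hs
        refine Or.inl ⟨_, Or.inr ⟨j, hi, hs, rfl⟩, ?_⟩
        rw [List.eraseIdx_append_of_length_le h, Nat.add_sub_cancel_left]
  · rintro (⟨Y, ⟨i, hi, rfl⟩ | ⟨i, hi, hs, rfl⟩, rfl⟩ | ⟨i, hi, rfl⟩ | ⟨i, hi, hs, rfl⟩)
    · refine Or.inl ⟨P.length + i, ?_, (List.take_length_add_append i).symm⟩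
      rwa [List.getElem?_append_right (by omega), Nat.add_sub_cancel_left]
    · have hj : 0 < i := Nat.pos_of_ne_zero fun h0 => hX.ne_socket (h0 ▸ hi)
      refine Or.inr ⟨P.length + i, ?_, (sandwiched_append_iff hj).not.mpr hs, ?_⟩
      · rwa [List.getElem?_append_right (by omega), Nat.add_sub_cancel_left]
      · rw [List.eraseIdx_append_of_length_le (by omega), Nat.add_sub_cancel_left]
    · have h := (List.getElem?_eq_some_iff.mp hi).1
      exact Or.inl ⟨i, by rwa [List.getElem?_append_left h],
        (List.take_append_of_le_length h.le).symm⟩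
    · have h := (List.getElem?_eq_some_iff.mp hi).1
      exact Or.inr ⟨i, by rwa [List.getElem?_append_left h], hs,
        (List.eraseIdx_append_of_lt_length h _).symm⟩

theorem carryOption_append_iff {P X L' : Component} (hX : BulbHeaded X) :
    CarryOption (P ++ X) L' ↔ (∃ Y, CarryOption X Y ∧ L' = P ++ Y) ∨
      (∃ i, P[i]? = some Piece.socket ∧ Sandwiched (P ++ X) i ∧ L' = P.eraseIdx i ++ X) := by
  constructor
  · rintro ⟨i, hi, hs, rfl⟩
    rcases lt_or_ge i P.length with h | h
    · rw [List.getElem?_append_left h] at hi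
      exact Or.inr ⟨i, hi, hs, List.eraseIdx_append_of_lt_length h _⟩
    · obtain ⟨j, rfl⟩ := Nat.exists_eq_add_of_le h
      rw [List.getElem?_append_right h, Nat.add_sub_cancel_left] at hi
      have hj : 0 < j := Nat.pos_of_ne_zero fun h0 => hX.ne_socket (h0 ▸ hi)
      rw [sandwiched_append_iff hj] at hs
      refine Or.inl ⟨_, ⟨j, hi, hs, rfl⟩, ?_⟩
      rw [List.eraseIdx_append_of_length_le h, Nat.add_sub_cancel_left]
  · rintro (⟨Y, ⟨i, hi, hs, rfl⟩, rfl⟩ | ⟨i, hi, hs, rfl⟩)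
    · have hj : 0 < i := Nat.pos_of_ne_zero fun h0 => hX.ne_socket (h0 ▸ hi)
      refine ⟨P.length + i, ?_, (sandwiched_append_iff hj).mpr hs, ?_⟩
      · rwa [List.getElem?_append_right (by omega), Nat.add_sub_cancel_left]
      · rw [List.eraseIdx_append_of_length_le (by omega), Nat.add_sub_cancel_left]
    · have h := (List.getElem?_eq_some_iff.mp hi).1
      exact ⟨i, by rwa [List.getElem?_append_left h], hs,
        (List.eraseIdx_append_of_lt_length h _).symm⟩

theorem getElem?_bulbs_append_sockets {k m i : ℕ} {p : Piece} :
    (bulbs k ++ sockets m)[i]? = some p ↔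
      (p = Piece.bulb ∧ i < k) ∨ (p = Piece.socket ∧ k ≤ i ∧ i < k + m) := by
  simp only [bulbs, sockets, List.getElem?_append, List.length_replicate, List.getElem?_replicate]
  cases p <;> grind

theorem eraseIdx_bulbs_append_sockets {k m i : ℕ} (h : k ≤ i) (h' : i < k + m) :
    (bulbs k ++ sockets m).eraseIdx i = bulbs k ++ sockets (m - 1) := by
  rw [List.eraseIdx_append_of_length_le (by simpa [bulbs] using h)]
  simp only [bulbs, sockets, List.length_replicate, List.eraseIdx_replicate]
  rw [if_pos (by omega)]

theorem sandwiched_bulbs_append_sockets_append_iff {k m i : ℕ} {X : Component}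
    (hX : BulbHeaded X) (h : k ≤ i) (h' : i < k + m) :
    Sandwiched (bulbs k ++ sockets m ++ X) i ↔ m = 1 ∧ 0 < k ∧ X ≠ [] := by
  unfold Sandwiched
  have hX' : X[0]? = some Piece.bulb ↔ X ≠ [] := by
    rcases hX with rfl | hX
    · simp
    · rw [← List.head?_eq_getElem?]
      refine iff_of_true hX ?_
      rintro rfl
      simp at hX
  rw [List.getElem?_append_left (by simp [bulbs, sockets]; omega),
    getElem?_bulbs_append_sockets]
  rcases lt_or_ge (i + 1) (k + m) with h1 | h1
  · rw [List.getElem?_append_left (by simpa [bulbs, sockets] using h1),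
      getElem?_bulbs_append_sockets]
    simp only [reduceCtorEq, false_and, or_false, true_and]
    omega
  · have h2 : i + 1 = k + m := by omega
    rw [List.getElem?_append_right (by simpa [bulbs, sockets] using h1),
      show i + 1 - (bulbs k ++ sockets m).length = 0 by simp [bulbs, sockets]; omega, hX']
    simp only [reduceCtorEq, false_and, or_false, true_and]
    constructor
    · rintro ⟨h2, h3, h4⟩
      exact ⟨by omega, by omega, h4⟩
    · rintro ⟨h2, h3, h4⟩
      exact ⟨by omega, by omega, h4⟩

theorem take_bulbs_append_sockets {k m i : ℕ} (h : i < k) :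
    (bulbs k ++ sockets m).take i = bulbs i := by
  rw [List.take_append_of_le_length (by simpa [bulbs] using h.le)]
  simp [bulbs, h.le]

theorem mem_quietValues_append_iff {k m : ℕ} {X : Component} (hX : BulbHeaded X) {v : ℕ∞} :
    v ∈ quietValues (bulbs k ++ sockets m ++ X) ↔
      (∃ Y, QuietOption X Y ∧ g (bulbs k ++ sockets m ++ Y) = v) ∨
      (∃ j < k, g (bulbs j) = v) ∨
      (0 < m ∧ ¬ (m = 1 ∧ 0 < k ∧ X ≠ []) ∧ g (bulbs k ++ sockets (m - 1) ++ X) = v) := by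
  simp only [quietValues, Set.mem_ofPred_eq, quietOption_append_iff hX,
    getElem?_bulbs_append_sockets, reduceCtorEq, false_and, or_false, true_and, false_or]
  constructor
  · rintro ⟨L', ⟨Y, hY, rfl⟩ | ⟨i, hi, rfl⟩ | ⟨i, hi, hs, rfl⟩, rfl⟩
    · exact Or.inl ⟨Y, hY, rfl⟩
    · exact Or.inr (Or.inl ⟨i, hi, by rw [take_bulbs_append_sockets hi]⟩)
    · rw [sandwiched_bulbs_append_sockets_append_iff hX hi.1 hi.2] at hs
      exact Or.inr (Or.inr ⟨by omega, hs, by rw [eraseIdx_bulbs_append_sockets hi.1 hi.2]⟩)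
  · rintro (⟨Y, hY, rfl⟩ | ⟨j, hj, rfl⟩ | ⟨hm, hs, rfl⟩)
    · exact ⟨_, Or.inl ⟨Y, hY, rfl⟩, rfl⟩
    · exact ⟨_, Or.inr (Or.inl ⟨j, hj, rfl⟩), by rw [take_bulbs_append_sockets hj]⟩
    · rw [← sandwiched_bulbs_append_sockets_append_iff hX le_rfl (by omega)] at hs
      exact ⟨_, Or.inr (Or.inr ⟨k, ⟨le_rfl, by omega⟩, hs, rfl⟩),
        by rw [eraseIdx_bulbs_append_sockets le_rfl (by omega)]⟩

theorem mem_carryValues_append_iff {k m : ℕ} {X : Component} (hX : BulbHeaded X) {v : ℕ∞} :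
    v ∈ carryValues (bulbs k ++ sockets m ++ X) ↔
      (∃ Y, CarryOption X Y ∧ g (bulbs k ++ sockets m ++ Y) = v) ∨
      (m = 1 ∧ 0 < k ∧ X ≠ [] ∧ g (bulbs k ++ X) = v) := by
  simp only [carryValues, Set.mem_ofPred_eq, carryOption_append_iff hX,
    getElem?_bulbs_append_sockets, reduceCtorEq, false_and, true_and, false_or]
  constructor
  · rintro ⟨L', ⟨Y, hY, rfl⟩ | ⟨i, hi, hs, rfl⟩, rfl⟩
    · exact Or.inl ⟨Y, hY, rfl⟩
    · rw [sandwiched_bulbs_append_sockets_append_iff hX hi.1 hi.2] at hs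
      obtain ⟨rfl, hs⟩ := hs
      refine Or.inr ⟨rfl, hs.1, hs.2, ?_⟩
      rw [eraseIdx_bulbs_append_sockets hi.1 hi.2]
      simp [sockets]
  · rintro (⟨Y, hY, rfl⟩ | ⟨rfl, hk, hne, rfl⟩)
    · exact ⟨_, Or.inl ⟨Y, hY, rfl⟩, rfl⟩
    · refine ⟨_, Or.inr ⟨k, ⟨le_rfl, by omega⟩,
        (sandwiched_bulbs_append_sockets_append_iff hX le_rfl (by omega)).mpr ⟨rfl, hk, hne⟩,
        rfl⟩, ?_⟩
      rw [eraseIdx_bulbs_append_sockets le_rfl (by omega)]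
      simp [sockets]

theorem BulbHeaded.quietOption {X Y : Component} (hX : BulbHeaded X) (h : QuietOption X Y) :
    BulbHeaded Y := by
  rcases h with ⟨i, hi, rfl⟩ | ⟨i, hi, -, rfl⟩
  · cases i with
    | zero => exact Or.inl rfl
    | succ i => cases X <;> simp_all [BulbHeaded]
  · cases i with
    | zero => exact absurd hi hX.ne_socket
    | succ i => cases X <;> simp_all [BulbHeaded]

theorem BulbHeaded.carryOption {X Y : Component} (hX : BulbHeaded X) (h : CarryOption X Y) :
    BulbHeaded Y := by
  obtain ⟨i, hi, -, rfl⟩ := h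
  cases i with
  | zero => exact absurd hi hX.ne_socket
  | succ i => cases X <;> simp_all [BulbHeaded]

theorem bulbHeaded_bulbs (n : ℕ) : BulbHeaded (bulbs n) := by
  cases n with
  | zero => exact Or.inl rfl
  | succ n => exact Or.inr rfl

theorem g_nil : g [] = 0 := rfl

theorem not_carryOption_bulbs (n : ℕ) (L' : Component) : ¬ CarryOption (bulbs n) L' := by
  rintro ⟨i, hi, -⟩
  simp [bulbs, List.getElem?_replicate] at hi

theorem quietOption_bulbs {n : ℕ} {Y : Component} (h : QuietOption (bulbs n) Y) :
    ∃ j < n, Y = bulbs j := by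
  rcases h with ⟨i, hi, rfl⟩ | ⟨i, hi, -⟩
  · have := (List.getElem?_eq_some_iff.mp hi).1
    simp only [bulbs, List.length_replicate] at this
    exact ⟨i, this, by simp [bulbs, this.le]⟩
  · simp [bulbs, List.getElem?_replicate] at hi

theorem quietOption_bulbs_of_lt {n j : ℕ} (h : j < n) : QuietOption (bulbs n) (bulbs j) :=
  Or.inl ⟨j, by simp [bulbs, h], by simp [bulbs, h.le]⟩

theorem carryValues_bulbs (n : ℕ) : carryValues (bulbs n) = ∅ := by
  simp [carryValues, not_carryOption_bulbs]

theorem g_bulbs (n : ℕ) : g (bulbs n) = n := by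
  induction n using Nat.strong_induction_on with
  | _ n ih =>
    rw [g_eq_coe_iff, carryValues_bulbs]
    refine ⟨?_, by simp, Or.inr fun j hj => ⟨_, quietOption_bulbs_of_lt hj, ih j hj⟩⟩
    rintro ⟨L', hL', h⟩
    obtain ⟨j, hj, rfl⟩ := quietOption_bulbs hL'
    rw [ih j hj, Nat.cast_inj] at h
    omega

theorem mem_quietValues_bulbs {n : ℕ} {v : ℕ∞} :
    v ∈ quietValues (bulbs n) ↔ ∃ j < n, (j : ℕ∞) = v := by
  constructor
  · rintro ⟨L', hL', rfl⟩
    obtain ⟨j, hj, rfl⟩ := quietOption_bulbs hL'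
    exact ⟨j, hj, (g_bulbs j).symm⟩
  · rintro ⟨j, hj, rfl⟩
    exact ⟨_, quietOption_bulbs_of_lt hj, g_bulbs j⟩

/-- The effect on values of prepending `k` bulbs followed by `m` sockets, computed on bulb
sequences. -/
noncomputable def prefixValue (k m : ℕ) (v : ℕ∞) : ℕ∞ :=
  if v = ⊤ then ⊤ else g (bulbs k ++ sockets m ++ bulbs v.toNat)

@[simp]
theorem prefixValue_top (k m : ℕ) : prefixValue k m ⊤ = ⊤ := by simp [prefixValue]

theorem prefixValue_coe (k m i : ℕ) :
    prefixValue k m i = g (bulbs k ++ sockets m ++ bulbs i) := by simp [prefixValue]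

theorem g_append_bulbs (k m i : ℕ) :
    g (bulbs k ++ sockets m ++ bulbs i) = prefixValue k m (g (bulbs i)) := by
  rw [g_bulbs, prefixValue_coe]

theorem prefixValue_zero_right (k i : ℕ) : prefixValue k 0 i = (k + i : ℕ) := by
  rw [prefixValue_coe, ← g_bulbs]
  simp [bulbs, sockets]

section Transfer

variable {k m : ℕ} {X : Component}

theorem mem_quietValues_append_iff_prefixValue (hX : BulbHeaded X)
    (hq : ∀ Y, QuietOption X Y → g (bulbs k ++ sockets m ++ Y) = prefixValue k m (g Y))
    (hm : 0 < m → g (bulbs k ++ sockets (m - 1) ++ X) = prefixValue k (m - 1) (g X)) {v : ℕ∞} :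
    v ∈ quietValues (bulbs k ++ sockets m ++ X) ↔
      (∃ w ∈ quietValues X, prefixValue k m w = v) ∨ (∃ j < k, (j : ℕ∞) = v) ∨
      (0 < m ∧ ¬ (m = 1 ∧ 0 < k ∧ X ≠ []) ∧ prefixValue k (m - 1) (g X) = v) := by
  rw [mem_quietValues_append_iff hX]
  refine or_congr ?_ (or_congr (by simp only [g_bulbs]) (and_congr_right fun h => by rw [hm h]))
  constructor
  · rintro ⟨Y, hY, rfl⟩
    exact ⟨_, ⟨Y, hY, rfl⟩, (hq Y hY).symm⟩
  · rintro ⟨_, ⟨Y, hY, rfl⟩, rfl⟩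
    exact ⟨Y, hY, hq Y hY⟩

theorem mem_carryValues_append_iff_prefixValue (hX : BulbHeaded X)
    (hc : ∀ Y, CarryOption X Y → g (bulbs k ++ sockets m ++ Y) = prefixValue k m (g Y))
    (hm : 0 < m → g (bulbs k ++ sockets (m - 1) ++ X) = prefixValue k (m - 1) (g X)) {v : ℕ∞} :
    v ∈ carryValues (bulbs k ++ sockets m ++ X) ↔
      (∃ w ∈ carryValues X, prefixValue k m w = v) ∨
      (m = 1 ∧ 0 < k ∧ X ≠ [] ∧ prefixValue k 0 (g X) = v) := by
  rw [mem_carryValues_append_iff hX]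
  refine or_congr ?_ (and_congr_right ?_)
  · constructor
    · rintro ⟨Y, hY, rfl⟩
      exact ⟨_, ⟨Y, hY, rfl⟩, (hc Y hY).symm⟩
    · rintro ⟨_, ⟨Y, hY, rfl⟩, rfl⟩
      exact ⟨Y, hY, hc Y hY⟩
  · rintro rfl
    have := hm one_pos
    simp only [sockets, Nat.sub_self, List.replicate_zero, List.append_nil] at this
    rw [this]

end Transfer

theorem bulbs_ne_nil {i : ℕ} : bulbs i ≠ [] ↔ i ≠ 0 := by simp [bulbs]

theorem mem_quietValues_append_bulbs {k m i : ℕ} {v : ℕ∞} :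
    v ∈ quietValues (bulbs k ++ sockets m ++ bulbs i) ↔
      (∃ j < i, prefixValue k m j = v) ∨ (∃ j < k, (j : ℕ∞) = v) ∨
      (0 < m ∧ ¬ (m = 1 ∧ 0 < k ∧ i ≠ 0) ∧ prefixValue k (m - 1) i = v) := by
  rw [mem_quietValues_append_iff_prefixValue (bulbHeaded_bulbs i), g_bulbs, bulbs_ne_nil]
  · simp only [mem_quietValues_bulbs]
    refine or_congr_left ⟨?_, ?_⟩
    · rintro ⟨_, ⟨j, hj, rfl⟩, h⟩
      exact ⟨j, hj, h⟩
    · rintro ⟨j, hj, h⟩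
      exact ⟨j, ⟨j, hj, rfl⟩, h⟩
  · intro Y hY
    obtain ⟨j, -, rfl⟩ := quietOption_bulbs hY
    exact g_append_bulbs _ _ _
  · exact fun _ => g_append_bulbs _ _ _

theorem mem_carryValues_append_bulbs {k m i : ℕ} {v : ℕ∞} :
    v ∈ carryValues (bulbs k ++ sockets m ++ bulbs i) ↔
      m = 1 ∧ 0 < k ∧ i ≠ 0 ∧ prefixValue k 0 i = v := by
  rw [mem_carryValues_append_iff_prefixValue (bulbHeaded_bulbs i), g_bulbs, bulbs_ne_nil,
    carryValues_bulbs]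
  · simp
  · exact fun Y hY => absurd hY (not_carryOption_bulbs i Y)
  · exact fun _ => g_append_bulbs _ _ _

theorem prefixValue_one_zero (k : ℕ) : prefixValue k 1 (0 : ℕ) = (k + 1 : ℕ) := by
  rw [prefixValue_coe, g_eq_coe_iff]
  simp only [mem_quietValues_append_bulbs, mem_carryValues_append_bulbs, Nat.sub_self,
    prefixValue_zero_right, Nat.cast_inj]
  refine ⟨?_, ?_, Or.inr fun j hj => ?_⟩
  · rintro (⟨j, hj, -⟩ | ⟨j, hj, h⟩ | ⟨-, -, h⟩) <;> omega
  · rintro v ⟨-, -, h, -⟩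
    exact absurd rfl h
  · rcases Nat.lt_or_ge j k with h | h
    · exact Or.inr (Or.inl ⟨j, h, rfl⟩)
    · exact Or.inr (Or.inr ⟨one_pos, by simp, by omega⟩)

theorem prefixValue_one_one (k : ℕ) (hk : 0 < k) : prefixValue k 1 (1 : ℕ) = ⊤ := by
  by_contra hne
  obtain ⟨n, hn⟩ := ENat.ne_top_iff_exists.mp hne
  rw [eq_comm, prefixValue_coe, g_eq_coe_iff] at hn
  obtain ⟨hq, hc, -⟩ := hn
  have h1 := hc _ (mem_carryValues_append_bulbs.mpr ⟨rfl, hk, one_ne_zero, rfl⟩)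
  rw [prefixValue_zero_right] at h1
  exact hq (mem_quietValues_append_bulbs.mpr
    (Or.inl ⟨0, one_pos, (prefixValue_one_zero k).trans h1⟩))

theorem prefixValue_one_of_two_le (k i : ℕ) (hk : 0 < k) (hi : 2 ≤ i) :
    prefixValue k 1 i = (k + i : ℕ) := by
  induction i using Nat.strong_induction_on with
  | _ i ih =>
    rw [prefixValue_coe, g_eq_coe_iff]
    refine ⟨?_, ?_, Or.inl ⟨_, mem_carryValues_append_bulbs.mpr ⟨rfl, hk, by omega, rfl⟩⟩⟩
    · rw [mem_quietValues_append_bulbs]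
      rintro (⟨j, hj, h⟩ | ⟨j, hj, h⟩ | ⟨-, h, -⟩)
      · obtain rfl | rfl | h2 : j = 0 ∨ j = 1 ∨ 2 ≤ j := by omega
        · rw [prefixValue_one_zero k, Nat.cast_inj] at h
          omega
        · rw [prefixValue_one_one k hk] at h
          exact ENat.top_ne_natCast _ h
        · rw [ih j hj h2, Nat.cast_inj] at h
          omega
      · rw [Nat.cast_inj] at h
        omega
      · exact h ⟨rfl, hk, by omega⟩
    · intro v hv
      obtain ⟨-, -, -, rfl⟩ := mem_carryValues_append_bulbs.mp hv
      rw [prefixValue_zero_right]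

theorem prefixValue_coe_eq_coe_iff {k m : ℕ} (hkm : ¬ (m = 1 ∧ 0 < k)) {i n : ℕ} :
    prefixValue k m i = n ↔
      ¬ ((∃ j < i, prefixValue k m j = n) ∨ n < k ∨ (0 < m ∧ prefixValue k (m - 1) i = n)) ∧
      ∀ l < n, (∃ j < i, prefixValue k m j = l) ∨ l < k ∨
        (0 < m ∧ prefixValue k (m - 1) i = l) := by
  have hc : carryValues (bulbs k ++ sockets m ++ bulbs i) = ∅ :=
    Set.eq_empty_of_forall_notMem fun v hv => by
      obtain ⟨h1, h2, -⟩ := mem_carryValues_append_bulbs.mp hv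
      exact hkm ⟨h1, h2⟩
  have hs : ¬ (m = 1 ∧ 0 < k ∧ i ≠ 0) := fun h => hkm ⟨h.1, h.2.1⟩
  rw [prefixValue_coe, g_eq_coe_iff, hc]
  simp only [mem_quietValues_append_bulbs, hs, not_false_eq_true, true_and, Nat.cast_inj,
    exists_eq_right]
  simp

theorem prefixValue_coe_ne_top {k m : ℕ} (hkm : ¬ (m = 1 ∧ 0 < k)) (i : ℕ) :
    prefixValue k m i ≠ ⊤ := by
  rw [prefixValue_coe]
  refine g_ne_top_of_carryValues_eq_empty (Set.eq_empty_of_forall_notMem fun v hv => ?_)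
  obtain ⟨h1, h2, -⟩ := mem_carryValues_append_bulbs.mp hv
  exact hkm ⟨h1, h2⟩

theorem prefixValue_injective_of_eq_coe {k m n : ℕ} {a b : ℕ∞} (ha : prefixValue k m a = n)
    (hb : prefixValue k m b = n) : a = b := by
  have hne : ∀ c : ℕ∞, prefixValue k m c = n → c ≠ ⊤ := by
    rintro c hc rfl
    rw [prefixValue_top] at hc
    exact ENat.top_ne_natCast _ hc
  obtain ⟨i, rfl⟩ := ENat.ne_top_iff_exists.mp (hne a ha)
  obtain ⟨j, rfl⟩ := ENat.ne_top_iff_exists.mp (hne b hb)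
  clear hne
  wlog hij : i < j generalizing i j with H
  · rcases (not_lt.mp hij).eq_or_lt with rfl | h
    · rfl
    · exact (H j hb i ha h).symm
  exfalso
  by_cases hkm : m = 1 ∧ 0 < k
  · obtain ⟨rfl, hk⟩ := hkm
    obtain rfl | hj : j = 1 ∨ 2 ≤ j := by omega
    · rw [prefixValue_one_one k hk] at hb
      exact ENat.top_ne_natCast _ hb
    rw [prefixValue_one_of_two_le k j hk hj, Nat.cast_inj] at hb
    obtain rfl | rfl | hi : i = 0 ∨ i = 1 ∨ 2 ≤ i := by omega
    · rw [prefixValue_one_zero k, Nat.cast_inj] at ha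
      omega
    · rw [prefixValue_one_one k hk] at ha
      exact ENat.top_ne_natCast _ ha
    · rw [prefixValue_one_of_two_le k i hk hi, Nat.cast_inj] at ha
      omega
  · exact ((prefixValue_coe_eq_coe_iff hkm).mp hb).1 (Or.inl ⟨i, hij, ha⟩)

/-- Prepending bulbs and then sockets to a bulb-headed component acts on its value. -/
theorem g_append_eq_prefixValue (k m : ℕ) (X : Component) (hX : BulbHeaded X) :
    g (bulbs k ++ sockets m ++ X) = prefixValue k m (g X) := by
  induction m using Nat.strong_induction_on generalizing X with
  | _ m ihm =>
  induction hlen : X.length using Nat.strong_induction_on generalizing X with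
  | _ l ihX =>
  subst hlen
  rcases eq_or_ne X [] with rfl | hne
  · exact g_append_bulbs k m 0
  have hQ := fun v => mem_quietValues_append_iff_prefixValue (v := v) hX
    (fun Y hY => ihX _ hY.length_lt Y (hX.quietOption hY) rfl)
    (fun h => ihm (m - 1) (by omega) X hX)
  have hC := fun v => mem_carryValues_append_iff_prefixValue (v := v) hX
    (fun Y hY => ihX _ hY.length_lt Y (hX.carryOption hY) rfl)
    (fun h => ihm (m - 1) (by omega) X hX)
  have hzero : ((0 : ℕ) : ℕ∞) ∈ quietValues X := by
    refine ⟨[], Or.inl ⟨0, ?_, rfl⟩, g_nil⟩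
    rcases hX with h | h
    · exact absurd h hne
    · rwa [← List.head?_eq_getElem?]
  rcases eq_or_ne (g X) ⊤ with htop | hfin
  · rw [htop, prefixValue_top]
    by_contra hn
    obtain ⟨n, hn⟩ := ENat.ne_top_iff_exists.mp hn
    obtain ⟨hq, hc, -⟩ := g_eq_coe_iff.mp hn.symm
    obtain ⟨w, hw⟩ : (carryValues X).Nonempty :=
      Set.nonempty_iff_ne_empty.mpr fun h => g_ne_top_of_carryValues_eq_empty h htop
    have hval : ∀ w ∈ carryValues X, prefixValue k m w = n := fun w hw =>
      hc _ ((hC _).mpr (Or.inl ⟨w, hw, rfl⟩))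
    obtain ⟨i, rfl⟩ := ENat.ne_top_iff_exists.mp (show w ≠ ⊤ by
      rintro rfl
      have := hval _ hw
      rw [prefixValue_top] at this
      exact ENat.top_ne_natCast _ this)
    have hgX : g X = i := g_eq_coe_iff.mpr
      ⟨fun hi => hq ((hQ _).mpr (Or.inl ⟨_, hi, hval _ hw⟩)),
        fun w' hw' => prefixValue_injective_of_eq_coe (hval _ hw') (hval _ hw), Or.inl ⟨_, hw⟩⟩
    exact ENat.top_ne_natCast _ (htop.symm.trans hgX)
  obtain ⟨i, hi⟩ := ENat.ne_top_iff_exists.mp hfin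
  obtain ⟨hqX, hcX, hexX⟩ := g_eq_coe_iff.mp hi.symm
  rw [← hi] at hQ hC ⊢
  have hi0 : i ≠ 0 := by
    rintro rfl
    exact hqX hzero
  by_cases hkm : m = 1 ∧ 0 < k
  · obtain ⟨rfl, hk⟩ := hkm
    obtain rfl | hi2 : i = 1 ∨ 2 ≤ i := by omega
    · rw [prefixValue_one_one k hk]
      by_contra hn
      obtain ⟨n, hn⟩ := ENat.ne_top_iff_exists.mp hn
      obtain ⟨hq, hc, -⟩ := g_eq_coe_iff.mp hn.symm
      have h1 := hc _ ((hC _).mpr (Or.inr ⟨rfl, hk, hne, rfl⟩))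
      rw [prefixValue_zero_right] at h1
      exact hq ((hQ _).mpr (Or.inl ⟨_, hzero, (prefixValue_one_zero k).trans h1⟩))
    · have hval := prefixValue_one_of_two_le k i hk hi2
      rw [hval, g_eq_coe_iff]
      refine ⟨?_, ?_, Or.inl ⟨_, (hC _).mpr (Or.inr ⟨rfl, hk, hne, rfl⟩)⟩⟩
      · rw [hQ]
        rintro (⟨w, hw, h⟩ | ⟨j, hj, h⟩ | ⟨-, h, -⟩)
        · exact hqX (prefixValue_injective_of_eq_coe h hval ▸ hw)
        · rw [Nat.cast_inj] at h
          omega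
        · exact h ⟨rfl, hk, hne⟩
      · intro v hv
        rcases (hC v).mp hv with ⟨w, hw, rfl⟩ | ⟨-, -, -, rfl⟩
        · rw [hcX w hw, hval]
        · exact prefixValue_zero_right k i
  · obtain ⟨n, hn⟩ := ENat.ne_top_iff_exists.mp (prefixValue_coe_ne_top hkm i)
    obtain ⟨hout, hin⟩ := (prefixValue_coe_eq_coe_iff hkm).mp hn.symm
    rw [← hn, g_eq_coe_iff]
    refine ⟨?_, ?_, hexX.imp ?_ fun hS l hl => ?_⟩
    · rw [hQ]
      rintro (⟨w, hw, h⟩ | ⟨j, hj, h⟩ | ⟨hm, -, h⟩)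
      · exact hqX (prefixValue_injective_of_eq_coe h hn.symm ▸ hw)
      · exact hout (Or.inr (Or.inl (Nat.cast_injective (R := ℕ∞) h ▸ hj)))
      · exact hout (Or.inr (Or.inr ⟨hm, h⟩))
    · intro v hv
      rcases (hC v).mp hv with ⟨w, hw, rfl⟩ | ⟨h1, h2, -⟩
      · rw [hcX w hw, hn]
      · exact absurd ⟨h1, h2⟩ hkm
    · rintro ⟨w, hw⟩
      exact ⟨_, (hC _).mpr (Or.inl ⟨w, hw, rfl⟩)⟩
    · rw [hQ]
      rcases hin l hl with ⟨j, hj, h⟩ | h | ⟨hm, h⟩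
      · exact Or.inl ⟨j, hS j hj, h⟩
      · exact Or.inr (Or.inl ⟨l, h, rfl⟩)
      · exact Or.inr (Or.inr ⟨hm, fun h' => hkm ⟨h'.1, h'.2.1⟩, h⟩)

/-- Let `X` and `X'` be bulb-headed components with the same finite
extended Grundy value `i`. If `g (bulb^k ++ socket^m ++ X)` is finite, then
`g (bulb^k ++ socket^m ++ X') = g (bulb^k ++ socket^m ++ X)`. -/
theorem stmt6 (k m i : ℕ) (X X' : Component)
    (hX : BulbHeaded X) (hX' : BulbHeaded X')
    (hgX : g X = (i : ℕ∞)) (hgX' : g X' = (i : ℕ∞))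
    (hfin : g (bulbs k ++ sockets m ++ X) ≠ ⊤) :
    g (bulbs k ++ sockets m ++ X') = g (bulbs k ++ sockets m ++ X) := by
  rw [g_append_eq_prefixValue k m X hX, g_append_eq_prefixValue k m X' hX', hgX, hgX']
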